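/- arXiv:0806.3442 — 2 statements merged into one kernel-verified Lean document; each statement's English description precedes it below -/
import Mathlib

section
/- Let N ≥ 2, let a ∈ ℝ³ be a unit vector, and let 1 ≤ M < N/2. Consider the N-tuple of unit vectors x = (x_1, …, x_N) with x_k = −a for k = 1, …, M and x_k = a for k = M+1, …, N, and define V(x) = (N/2)(1 − ‖(1/N) ∑_{k=1}^N x_k‖²). Then x is not a local minimum of V on N-tuples of unit vectors: for every ε > 0 there exists an N-tuple of unit vectors y = (y_1, …, y_N) with ‖y_k − x_k‖ < ε for all k and V(y) < V(x). -/
noncomputable section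

/-- Euclidean norm on `ℝ³` (represented as `Fin 3 → ℝ`). -/
def norm3 (v : Fin 3 → ℝ) : ℝ := Real.sqrt (∑ i, v i ^ 2)

/-- The synchrony potential `V(x) = (N/2)(1 − ‖(1/N) ∑_k x_k‖²)` on `N`-tuples of vectors. -/
def syncPot (N : ℕ) (x : Fin N → Fin 3 → ℝ) : ℝ :=
  ((N : ℝ) / 2) * (1 - norm3 ((N : ℝ)⁻¹ • ∑ k, x k) ^ 2)

theorem norm3_sq (v : Fin 3 → ℝ) : norm3 v ^ 2 = v 0 ^ 2 + v 1 ^ 2 + v 2 ^ 2 := by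
  rw [norm3, Real.sq_sqrt (Finset.sum_nonneg fun i _ => sq_nonneg _), Fin.sum_univ_three]

theorem norm3_nonneg (v : Fin 3 → ℝ) : 0 ≤ norm3 v := Real.sqrt_nonneg _

/-- Squared norm of a combination of two orthonormal vectors. -/
theorem norm3_sq_combination {a b : Fin 3 → ℝ} (ha : norm3 a = 1) (hb : norm3 b = 1)
    (hab : a 0 * b 0 + a 1 * b 1 + a 2 * b 2 = 0) (p q : ℝ) :
    norm3 (p • a + q • b) ^ 2 = p ^ 2 + q ^ 2 := by
  have ha2 := norm3_sq a
  have hb2 := norm3_sq b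
  rw [ha] at ha2
  rw [hb] at hb2
  rw [norm3_sq]
  simp only [Pi.add_apply, Pi.smul_apply, smul_eq_mul]
  linear_combination (-p ^ 2) * ha2 - q ^ 2 * hb2 + 2 * p * q * hab

theorem exists_unit_orthogonal (a : Fin 3 → ℝ) :
    ∃ b : Fin 3 → ℝ, norm3 b = 1 ∧ a 0 * b 0 + a 1 * b 1 + a 2 * b 2 = 0 := by
  by_cases h : a 0 ^ 2 + a 1 ^ 2 = 0
  · have h0 : a 0 = 0 := by nlinarith [sq_nonneg (a 0), sq_nonneg (a 1)]
    exact ⟨![1, 0, 0], by simp [norm3, Fin.sum_univ_three], by simp [h0]⟩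
  · have hr := Real.sq_sqrt (show 0 ≤ a 0 ^ 2 + a 1 ^ 2 by positivity)
    set r := √(a 0 ^ 2 + a 1 ^ 2)
    have hr0 : r ≠ 0 := by
      intro hr0
      apply h
      rw [← hr, hr0]
      norm_num
    refine ⟨![a 1 / r, -a 0 / r, 0], ?_, ?_⟩
    · rw [← sq_eq_sq₀ (norm3_nonneg _) zero_le_one, norm3_sq]
      simp only [Matrix.cons_val]
      field_simp
      linarith
    · simp only [Matrix.cons_val]
      ring

theorem sum_antialigned {N M : ℕ} (hMN : M ≤ N) (a : Fin 3 → ℝ) :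
    ∑ k : Fin N, (if (k : ℕ) < M then -a else a) = ((N : ℝ) - 2 * M) • a := by
  obtain ⟨L, rfl⟩ := Nat.exists_eq_add_of_le hMN
  rw [Fin.sum_univ_add]
  ext i
  simp
  ring

theorem syncPot_lt_syncPot {N : ℕ} (hN : 0 < N) {x y : Fin N → Fin 3 → ℝ}
    (h : norm3 (∑ k, x k) ^ 2 < norm3 (∑ k, y k) ^ 2) : syncPot N y < syncPot N x := by
  have hN' : (0 : ℝ) < N := Nat.cast_pos.mpr hN
  have hscale (v : Fin 3 → ℝ) :
      norm3 ((N : ℝ)⁻¹ • v) ^ 2 = ((N : ℝ)⁻¹) ^ 2 * norm3 v ^ 2 := by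
    simp only [norm3_sq, Pi.smul_apply, smul_eq_mul]
    ring
  unfold syncPot
  rw [hscale, hscale]
  gcongr

/-- A configuration with `M` unit vectors anti-aligned and `N − M` aligned with a
unit vector `a` (`1 ≤ M < N/2`) is not a local minimum of the synchrony potential on `N`-tuples of
unit vectors: arbitrarily close tuples of unit vectors attain a strictly smaller value. -/
theorem antialigned_configuration_not_local_min
    (N M : ℕ) (hN : 2 ≤ N) (hM1 : 1 ≤ M) (hM2 : 2 * M < N)
    (a : Fin 3 → ℝ) (ha : norm3 a = 1)
    (x : Fin N → Fin 3 → ℝ)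
    (hx : ∀ k : Fin N, x k = if (k : ℕ) < M then -a else a) :
    ∀ ε : ℝ, 0 < ε →
      ∃ y : Fin N → Fin 3 → ℝ,
        (∀ k, norm3 (y k) = 1) ∧
        (∀ k, norm3 (y k - x k) < ε) ∧
        syncPot N y < syncPot N x := by
  intro ε hε
  obtain ⟨b, hb, hab⟩ := exists_unit_orthogonal a
  -- Tilt a single anti-aligned vector towards `b`, with cosine `1 - δ` and sine `s`.
  obtain ⟨δ, hδ0, hδ1, hδε⟩ : ∃ δ : ℝ, 0 < δ ∧ δ ≤ 1 ∧ 2 * δ < ε ^ 2 :=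
    ⟨min 1 (ε ^ 2 / 4), by positivity, min_le_left _ _, by
      have := min_le_right 1 (ε ^ 2 / 4)
      have : 0 < ε ^ 2 := by positivity
      linarith⟩
  have hs := Real.sq_sqrt (show 0 ≤ 1 - (1 - δ) ^ 2 by nlinarith)
  set s := √(1 - (1 - δ) ^ 2)
  let k₀ : Fin N := ⟨0, by omega⟩
  have hx₀ : x k₀ = -a := by rw [hx, if_pos (show (k₀ : ℕ) < M from hM1)]
  refine ⟨Function.update x k₀ (x k₀ + (δ • a + s • b)), fun k => ?_, fun k => ?_, ?_⟩
  · rw [← sq_eq_sq₀ (norm3_nonneg _) zero_le_one]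
    by_cases hk : k = k₀
    · subst hk
      rw [Function.update_self, hx₀,
        show -a + (δ • a + s • b) = (δ - 1) • a + s • b by module,
        norm3_sq_combination ha hb hab, hs]
      ring
    · rw [Function.update_of_ne hk, hx, ← ha]
      split_ifs <;> simp [norm3_sq]
  · by_cases hk : k = k₀
    · subst hk
      rw [Function.update_self, add_sub_cancel_left, ← sq_lt_sq₀ (norm3_nonneg _) hε.le,
        norm3_sq_combination ha hb hab, hs]
      linarith
    · rw [Function.update_of_ne hk]
      simpa [norm3] using hε
  · have hsum : ∑ k, x k = ((N : ℝ) - 2 * M) • a := by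
      simp only [hx]
      exact sum_antialigned (by omega) a
    have hpos : (0 : ℝ) < N - 2 * M := by
      have : (2 * M : ℝ) < N := by exact_mod_cast hM2
      linarith
    have hsum' : ∑ k, Function.update x k₀ (x k₀ + (δ • a + s • b)) k =
        ((N : ℝ) - 2 * M + δ) • a + s • b := by
      rw [Finset.sum_update_of_mem (Finset.mem_univ k₀), add_right_comm,
        ← Finset.erase_eq, Finset.add_sum_erase _ _ (Finset.mem_univ k₀), hsum]
      module
    apply syncPot_lt_syncPot (by omega)
    rw [hsum', hsum, norm3_sq_combination ha hb hab,
      show ((N : ℝ) - 2 * M) • a = ((N : ℝ) - 2 * M) • a + (0 : ℝ) • b by module,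
      norm3_sq_combination ha hb hab]
    nlinarith [mul_pos hpos hδ0, sq_nonneg s]
end
end

section
/- Let b ∈ ℝ³ with b ≠ 0 and let x : [0, ∞) → ℝ³ be a C¹ function with ‖x(0)‖ = 1 satisfying ẋ = (x × b) × x for all t ≥ 0. Then ‖x(t)‖ = 1 for all t ≥ 0, and if x(0) ≠ −b/‖b‖, then x(t) → b/‖b‖ as t → ∞. Moreover the equilibrium x ≡ −b/‖b‖ is unstable, in the sense that there exist initial conditions arbitrarily close to −b/‖b‖ on the unit sphere whose solutions converge to b/‖b‖. -/
open Filter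

noncomputable section

/-- The cross product on `ℝ³`. -/
def cross3 (u v : Fin 3 → ℝ) : Fin 3 → ℝ := crossProduct u v

lemma norm3_eq_sqrt_dotProduct (v : Fin 3 → ℝ) : norm3 v = Real.sqrt (v ⬝ᵥ v) := by
  simp [norm3, dotProduct, sq]

lemma norm3_eq_one_iff {v : Fin 3 → ℝ} : norm3 v = 1 ↔ v ⬝ᵥ v = 1 := by
  rw [norm3_eq_sqrt_dotProduct, Real.sqrt_eq_one]

lemma norm3_mul_self (v : Fin 3 → ℝ) : norm3 v * norm3 v = v ⬝ᵥ v := by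
  rw [norm3_eq_sqrt_dotProduct]
  exact Real.mul_self_sqrt (by simpa using dotProduct_star_self_nonneg v)

lemma norm3_pos {v : Fin 3 → ℝ} (hv : v ≠ 0) : 0 < norm3 v := by
  rw [norm3_eq_sqrt_dotProduct]
  exact Real.sqrt_pos.2 (by simpa using Matrix.dotProduct_star_self_pos_iff.2 hv)

lemma cross3_cross3_self (x b : Fin 3 → ℝ) :
    cross3 (cross3 x b) x = (x ⬝ᵥ x) • b - (x ⬝ᵥ b) • x := by
  ext i
  fin_cases i <;> simp [cross3, cross_apply, dotProduct, Fin.sum_univ_three] <;> ring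

lemma HasDerivAt.dotProduct_fin {n : ℕ} {x y : ℝ → Fin n → ℝ} {x' y' : Fin n → ℝ} {t : ℝ}
    (hx : HasDerivAt x x' t) (hy : HasDerivAt y y' t) :
    HasDerivAt (fun s => x s ⬝ᵥ y s) (x' ⬝ᵥ y t + x t ⬝ᵥ y') t := by
  simp only [dotProduct, ← Finset.sum_add_distrib]
  exact HasDerivAt.fun_sum fun i _ => (hasDerivAt_pi.1 hx i).mul (hasDerivAt_pi.1 hy i)

lemma dotProduct_self_eq_one_of_hasDerivAt {b : Fin 3 → ℝ} {x : ℝ → Fin 3 → ℝ}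
    (hinit : x 0 ⬝ᵥ x 0 = 1)
    (hdyn : ∀ t : ℝ, 0 ≤ t → HasDerivAt x (cross3 (cross3 (x t) b) (x t)) t)
    {t : ℝ} (ht : 0 ≤ t) : x t ⬝ᵥ x t = 1 := by
  have hd : ∀ s : ℝ, 0 ≤ s → HasDerivAt (fun s => x s ⬝ᵥ x s) 0 s := by
    intro s hs
    convert (hdyn s hs).dotProduct_fin (hdyn s hs) using 1
    rw [cross3_cross3_self]
    simp only [sub_dotProduct, dotProduct_sub, smul_dotProduct, dotProduct_smul, smul_eq_mul,
      dotProduct_comm b]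
    ring
  rw [← hinit]
  exact constant_of_has_deriv_right_zero (f := fun s => x s ⬝ᵥ x s)
    (fun s hs => (hd s hs.1).continuousAt.continuousWithinAt)
    (fun s hs => (hd s hs.1).hasDerivWithinAt) t ⟨ht, le_rfl⟩

/-- If `q ≥ 0` and `p > 0` initially exchange mass at rate `p * q`, then `q` decays to zero. -/
lemma tendsto_zero_of_hasDerivAt_exchange {p q : ℝ → ℝ}
    (hp : ∀ t, 0 ≤ t → HasDerivAt p (p t * q t) t)
    (hq : ∀ t, 0 ≤ t → HasDerivAt q (-(p t * q t)) t)
    (hp_nonneg : ∀ t, 0 ≤ t → 0 ≤ p t) (hq_nonneg : ∀ t, 0 ≤ t → 0 ≤ q t) (hp0 : 0 < p 0) :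
    Tendsto q atTop (nhds 0) := by
  have hmono : MonotoneOn p (Set.Ici 0) := by
    refine monotoneOn_of_hasDerivWithinAt_nonneg (f' := fun t => p t * q t) (convex_Ici 0)
      (fun t ht => (hp t ht).continuousAt.continuousWithinAt)
      (fun t ht => (hp t (interior_subset ht)).hasDerivWithinAt) fun t ht => ?_
    exact mul_nonneg (hp_nonneg t (interior_subset ht)) (hq_nonneg t (interior_subset ht))
  have hd : ∀ t, 0 ≤ t → HasDerivAt (fun t => q t * Real.exp (p 0 * t))
      (-(p t * q t) * Real.exp (p 0 * t) + q t * (Real.exp (p 0 * t) * (p 0 * 1))) t :=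
    fun t ht => (hq t ht).mul ((hasDerivAt_id t).const_mul (p 0)).exp
  have hanti : AntitoneOn (fun t => q t * Real.exp (p 0 * t)) (Set.Ici 0) := by
    refine antitoneOn_of_hasDerivWithinAt_nonpos (convex_Ici 0)
      (fun t ht => (hd t ht).continuousAt.continuousWithinAt)
      (fun t ht => (hd t (interior_subset ht)).hasDerivWithinAt) fun t ht => ?_
    have ht' : (0 : ℝ) ≤ t := interior_subset ht
    have h := mul_nonneg (mul_nonneg (hq_nonneg t ht') (Real.exp_pos (p 0 * t)).le)
      (sub_nonneg.2 (hmono Set.self_mem_Ici ht' ht'))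
    linarith
  have hexp : Tendsto (fun t => q 0 * Real.exp (-(p 0 * t))) atTop (nhds 0) := by
    simpa using (Real.tendsto_exp_neg_atTop_nhds_zero.comp
      (tendsto_id.const_mul_atTop hp0)).const_mul (q 0)
  refine tendsto_of_tendsto_of_tendsto_of_le_of_le' tendsto_const_nhds hexp ?_ ?_
  · filter_upwards [eventually_ge_atTop 0] with t ht using hq_nonneg t ht
  · filter_upwards [eventually_ge_atTop 0] with t ht
    have h := hanti Set.self_mem_Ici ht ht
    simp only [mul_zero, Real.exp_zero, mul_one] at h
    rwa [Real.exp_neg, ← div_eq_mul_inv, le_div_iff₀ (Real.exp_pos _)]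

lemma tendsto_of_tendsto_dotProduct_sub_self {x : ℝ → Fin 3 → ℝ} {u : Fin 3 → ℝ}
    (h : Tendsto (fun t => (x t - u) ⬝ᵥ (x t - u)) atTop (nhds 0)) : Tendsto x atTop (nhds u) := by
  rw [tendsto_pi_nhds]
  intro i
  rw [tendsto_iff_norm_sub_tendsto_zero]
  have hs := (Real.continuous_sqrt.tendsto 0).comp h
  rw [Real.sqrt_zero] at hs
  refine squeeze_zero (fun t => norm_nonneg _) (fun t => ?_) hs
  refine Real.abs_le_sqrt ?_
  rw [sq]
  exact Finset.single_le_sum (f := fun j => (x t - u) j * (x t - u) j)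
    (fun j _ => mul_self_nonneg _) (Finset.mem_univ i)

lemma dotProduct_normalize_self {b : Fin 3 → ℝ} (hb : b ≠ 0) :
    ((norm3 b)⁻¹ • b) ⬝ᵥ ((norm3 b)⁻¹ • b) = 1 := by
  have h := (norm3_pos hb).ne'
  simp only [smul_dotProduct, dotProduct_smul, smul_eq_mul, ← norm3_mul_self]
  field_simp

lemma norm3_smul_normalize {b : Fin 3 → ℝ} (hb : b ≠ 0) :
    norm3 b • ((norm3 b)⁻¹ • b) = b :=
  smul_inv_smul₀ (norm3_pos hb).ne' b

/-- Solutions on the unit sphere that do not start at the antipode converge to the maximiser. -/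
lemma tendsto_normalize_of_hasDerivAt {b : Fin 3 → ℝ} (hb : b ≠ 0) {x : ℝ → Fin 3 → ℝ}
    (hinit : x 0 ⬝ᵥ x 0 = 1)
    (hdyn : ∀ t : ℝ, 0 ≤ t → HasDerivAt x (cross3 (cross3 (x t) b) (x t)) t)
    (hne : x 0 ≠ -((norm3 b)⁻¹ • b)) : Tendsto x atTop (nhds ((norm3 b)⁻¹ • b)) := by
  have hβ := norm3_pos hb
  have huu := dotProduct_normalize_self hb
  have hbu := norm3_smul_normalize hb
  generalize norm3 b = β at *
  generalize β⁻¹ • b = u at *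
  subst hbu
  have hxx : ∀ t, 0 ≤ t → x t ⬝ᵥ x t = 1 := fun t =>
    dotProduct_self_eq_one_of_hasDerivAt hinit hdyn
  have hsub : ∀ t, 0 ≤ t → (x t - u) ⬝ᵥ (x t - u) = 2 * (1 - x t ⬝ᵥ u) := by
    intro t ht
    simp only [sub_dotProduct, dotProduct_sub, hxx t ht, huu, dotProduct_comm u]
    ring
  have hadd : ∀ t, 0 ≤ t → (x t + u) ⬝ᵥ (x t + u) = 2 * (1 + x t ⬝ᵥ u) := by
    intro t ht
    simp only [add_dotProduct, dotProduct_add, hxx t ht, huu, dotProduct_comm u]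
    ring
  have hd : ∀ t, 0 ≤ t →
      HasDerivAt (fun t => x t ⬝ᵥ u) (β * ((1 + x t ⬝ᵥ u) * (1 - x t ⬝ᵥ u))) t := by
    intro t ht
    convert (hdyn t ht).dotProduct_fin (hasDerivAt_const t u) using 1
    rw [cross3_cross3_self, hxx t ht]
    simp only [sub_dotProduct, smul_dotProduct, dotProduct_smul, smul_eq_mul, huu,
      dotProduct_zero]
    ring
  have hnonneg : ∀ v : Fin 3 → ℝ, 0 ≤ v ⬝ᵥ v := fun v => by
    simpa using dotProduct_star_self_nonneg v
  have hlim : Tendsto (fun t => β * (1 - x t ⬝ᵥ u)) atTop (nhds 0) := by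
    refine tendsto_zero_of_hasDerivAt_exchange (p := fun t => β * (1 + x t ⬝ᵥ u)) ?_ ?_ ?_ ?_ ?_
    · intro t ht
      exact (((hd t ht).const_add 1).const_mul β).congr_deriv (by ring)
    · intro t ht
      exact (((hd t ht).const_sub 1).const_mul β).congr_deriv (by ring)
    · intro t ht
      exact mul_nonneg hβ.le (by linarith [hadd t ht, hnonneg (x t + u)])
    · intro t ht
      exact mul_nonneg hβ.le (by linarith [hsub t ht, hnonneg (x t - u)])
    · have h : 0 < (x 0 + u) ⬝ᵥ (x 0 + u) := by
        simpa using Matrix.dotProduct_star_self_pos_iff.2 fun h => hne (eq_neg_of_add_eq_zero_left h)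
      exact mul_pos hβ (by linarith [hadd 0 le_rfl])
  apply tendsto_of_tendsto_dotProduct_sub_self
  have h := hlim.const_mul (2 / β)
  rw [mul_zero] at h
  refine h.congr' ?_
  filter_upwards [eventually_ge_atTop 0] with t ht
  rw [hsub t ht]
  field_simp

lemma exists_unit_dotProduct_eq_zero (u : Fin 3 → ℝ) :
    ∃ v : Fin 3 → ℝ, v ⬝ᵥ v = 1 ∧ v ⬝ᵥ u = 0 := by
  obtain ⟨w, hw, hwu⟩ : ∃ w : Fin 3 → ℝ, w ≠ 0 ∧ w ⬝ᵥ u = 0 := by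
    by_cases h : u 0 = 0
    · refine ⟨![1, 0, 0], fun h' => ?_, by simp [dotProduct, Fin.sum_univ_three, h]⟩
      simpa using congrFun h' 0
    · refine ⟨![u 1, -u 0, 0], fun h' => h ?_, ?_⟩
      · simpa using congrFun h' 1
      · simp [dotProduct, Fin.sum_univ_three]
        ring
  exact ⟨(norm3 w)⁻¹ • w, dotProduct_normalize_self hw, by simp [hwu]⟩

/-- The great-circle solution `tanh θ • u + sech θ • v` with `θ = β t - T`. -/
def greatCircleSolution (u v : Fin 3 → ℝ) (β T t : ℝ) : Fin 3 → ℝ :=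
  (Real.cosh (β * t - T))⁻¹ • (Real.sinh (β * t - T) • u + v)

lemma dotProduct_greatCircleSolution {u v : Fin 3 → ℝ} (huu : u ⬝ᵥ u = 1) (hvv : v ⬝ᵥ v = 1)
    (hvu : v ⬝ᵥ u = 0) (β T t : ℝ) :
    greatCircleSolution u v β T t ⬝ᵥ greatCircleSolution u v β T t = 1 ∧
      greatCircleSolution u v β T t ⬝ᵥ u = Real.sinh (β * t - T) / Real.cosh (β * t - T) ∧
      greatCircleSolution u v β T t ⬝ᵥ v = (Real.cosh (β * t - T))⁻¹ := by
  have hc := (Real.cosh_pos (β * t - T)).ne'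
  have hsq := Real.cosh_sq (β * t - T)
  simp only [greatCircleSolution, smul_dotProduct, dotProduct_smul, add_dotProduct,
    dotProduct_add, smul_eq_mul, huu, hvv, hvu, dotProduct_comm u v]
  refine ⟨?_, ?_, ?_⟩ <;> field_simp <;> linarith

lemma hasDerivAt_greatCircleSolution {u v : Fin 3 → ℝ} (huu : u ⬝ᵥ u = 1) (hvv : v ⬝ᵥ v = 1)
    (hvu : v ⬝ᵥ u = 0) (β T t : ℝ) :
    HasDerivAt (greatCircleSolution u v β T)
      (cross3 (cross3 (greatCircleSolution u v β T t) (β • u)) (greatCircleSolution u v β T t))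
      t := by
  obtain ⟨hyy, hyu, -⟩ := dotProduct_greatCircleSolution huu hvv hvu β T t
  have hc := (Real.cosh_pos (β * t - T)).ne'
  have hsq := Real.cosh_sq (β * t - T)
  have hθ : HasDerivAt (fun t => β * t - T) (β * 1) t :=
    ((hasDerivAt_id t).const_mul β).sub_const T
  refine ((hθ.cosh.inv hc).smul ((hθ.sinh.smul_const u).add_const v)).congr_deriv ?_
  rw [cross3_cross3_self, hyy, dotProduct_smul, hyu, greatCircleSolution]
  ext i
  simp only [Pi.sub_apply, Pi.add_apply, Pi.smul_apply, smul_eq_mul, Pi.inv_apply]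
  field_simp
  rw [hsq]
  ring

lemma exists_two_mul_one_sub_tanh_lt {δ : ℝ} (hδ : 0 < δ) :
    ∃ T : ℝ, 2 * (1 - Real.sinh T / Real.cosh T) < δ := by
  refine ⟨-Real.log (δ / 4), ?_⟩
  set T := -Real.log (δ / 4) with hT
  have hexp : Real.exp (-T) = δ / 4 := by rw [hT, neg_neg, Real.exp_log (by positivity)]
  have hc := Real.cosh_pos T
  have h : 1 - Real.sinh T / Real.cosh T = Real.exp (-T) / Real.cosh T := by
    rw [← Real.cosh_sub_sinh]
    field_simp
  have h' : Real.exp (-T) / Real.cosh T ≤ Real.exp (-T) :=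
    div_le_self (Real.exp_pos _).le (Real.one_le_cosh T)
  linarith

/-- For `b ≠ 0`, along the single-particle dynamics `ẋ = (x × b) × x` on
`[0, ∞)` with `‖x(0)‖ = 1`, the norm `‖x(t)‖` stays `1`; if `x(0) ≠ −b/‖b‖` then
`x(t) → b/‖b‖`; and the equilibrium `−b/‖b‖` is unstable: there are unit initial conditions
arbitrarily close to `−b/‖b‖` whose solutions converge to `b/‖b‖`. -/
theorem limiting_single_particle_dynamics
    (b : Fin 3 → ℝ) (hb : b ≠ 0)
    (x : ℝ → Fin 3 → ℝ)
    (hinit : norm3 (x 0) = 1)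
    (hdyn : ∀ t : ℝ, 0 ≤ t → HasDerivAt x (cross3 (cross3 (x t) b) (x t)) t) :
    (∀ t : ℝ, 0 ≤ t → norm3 (x t) = 1) ∧
    (x 0 ≠ -((norm3 b)⁻¹ • b) → Tendsto x atTop (nhds ((norm3 b)⁻¹ • b))) ∧
    (∀ ε : ℝ, 0 < ε →
      ∃ y : ℝ → Fin 3 → ℝ,
        (∀ t : ℝ, 0 ≤ t → HasDerivAt y (cross3 (cross3 (y t) b) (y t)) t) ∧
        norm3 (y 0) = 1 ∧
        norm3 (y 0 - -((norm3 b)⁻¹ • b)) < ε ∧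
        Tendsto y atTop (nhds ((norm3 b)⁻¹ • b))) := by
  have hinit' := norm3_eq_one_iff.1 hinit
  refine ⟨fun t ht => norm3_eq_one_iff.2 (dotProduct_self_eq_one_of_hasDerivAt hinit' hdyn ht),
    tendsto_normalize_of_hasDerivAt hb hinit' hdyn, fun ε hε => ?_⟩
  have huu := dotProduct_normalize_self hb
  obtain ⟨v, hvv, hvu⟩ := exists_unit_dotProduct_eq_zero ((norm3 b)⁻¹ • b)
  obtain ⟨T, hT⟩ := exists_two_mul_one_sub_tanh_lt (pow_pos hε 2)
  have hy := hasDerivAt_greatCircleSolution huu hvv hvu (norm3 b) T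
  obtain ⟨hyy, hyu, hyv⟩ := dotProduct_greatCircleSolution huu hvv hvu (norm3 b) T 0
  rw [norm3_smul_normalize hb] at hy
  refine ⟨greatCircleSolution ((norm3 b)⁻¹ • b) v (norm3 b) T, fun t _ => hy t,
    norm3_eq_one_iff.2 hyy, ?_, tendsto_normalize_of_hasDerivAt hb hyy (fun t _ => hy t) ?_⟩
  · rw [norm3_eq_sqrt_dotProduct, Real.sqrt_lt' hε]
    refine lt_of_eq_of_lt ?_ hT
    generalize greatCircleSolution ((norm3 b)⁻¹ • b) v (norm3 b) T 0 = y at *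
    generalize (norm3 b)⁻¹ • b = u at *
    rw [sub_neg_eq_add, add_dotProduct, dotProduct_add, dotProduct_add, dotProduct_comm u y,
      hyy, hyu, huu, mul_zero, zero_sub, Real.sinh_neg, Real.cosh_neg]
    ring
  · intro h
    rw [h, neg_dotProduct, dotProduct_comm, hvu, neg_zero] at hyv
    exact (inv_pos.2 (Real.cosh_pos _)).ne hyv
end
end
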